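/- arXiv:1612.09406 — 2 statements merged into one kernel-verified Lean document; each statement's English description precedes it below -/
import Mathlib

section
/- Let h₁ = (y−z)²z − x³ − x²z and h₂ = x³ − 2xy² + 2xyz + y²z in ℂ[x,y,z]. Every homogeneous polynomial f of degree 10 in ℂ[x,y,z] satisfying all of the following conditions is the zero polynomial: (i) for every nonzero (a,b,c) ∈ ℂ³ with h₁(a,b,c) = h₂(a,b,c) = 0, every iterated partial derivative of f of total order < 3 vanishes at (a,b,c); (ii) every iterated partial derivative of f of total order < 5 vanishes at (4,9,6); (iii) every iterated partial derivative of f of total order < 5 vanishes at (0,1,1); (iv) every iterated partial derivative of f of total order < 6 vanishes at (0,0,1). -/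
open MvPolynomial

/-- `f` vanishes to order at least `m` at the point `p ∈ ℂ³`: every iterated partial
derivative of `f` of total order `< m` vanishes at `p`. -/
def VanishesToOrder (f : MvPolynomial (Fin 3) ℂ) (p : Fin 3 → ℂ) (m : ℕ) : Prop :=
  ∀ L : List (Fin 3), L.length < m →
    MvPolynomial.eval p (L.foldr (fun i g => MvPolynomial.pderiv i g) f) = 0

/-- The nodal cubic `h₁ = (y-z)²z - x³ - x²z`. -/
noncomputable def h₁ : MvPolynomial (Fin 3) ℂ :=
  (X 1 - X 2) ^ 2 * X 2 - X 0 ^ 3 - X 0 ^ 2 * X 2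

/-- The nodal cubic `h₂ = x³ - 2xy² + 2xyz + y²z`. -/
noncomputable def h₂ : MvPolynomial (Fin 3) ℂ :=
  X 0 ^ 3 - 2 * X 0 * X 1 ^ 2 + 2 * X 0 * X 1 * X 2 + X 1 ^ 2 * X 2

/-- Order of vanishing drops by at most one under a partial derivative. -/
lemma VanishesToOrder.pderiv {f : MvPolynomial (Fin 3) ℂ} {p : Fin 3 → ℂ} {m : ℕ}
    (h : VanishesToOrder f p (m + 1)) (i : Fin 3) :
    VanishesToOrder (MvPolynomial.pderiv i f) p m := fun L hL => by
  simpa using h (L ++ [i]) (by simpa using hL)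

/-- The chain rule along a polynomial curve. -/
lemma derivative_aeval_eq_sum (f : MvPolynomial (Fin 3) ℂ) (γ : Fin 3 → Polynomial ℂ) :
    Polynomial.derivative (aeval γ f) =
      ∑ i, aeval γ (pderiv i f) * Polynomial.derivative (γ i) := by
  induction f using MvPolynomial.induction_on with
  | C a => simp
  | add p q hp hq => simp [hp, hq, add_mul, Finset.sum_add_distrib]
  | mul_X p j hp =>
    simp only [pderiv_mul, pderiv_X, map_mul, map_add, aeval_X, Polynomial.derivative_mul, hp,
      add_mul, Finset.sum_add_distrib, Finset.sum_mul]
    refine congrArg₂ (· + ·) (Finset.sum_congr rfl fun i _ => by ring) ?_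
    rw [Finset.sum_eq_single j (fun i _ hij => by simp [hij.symm]) (by simp)]
    simp

lemma eval_aeval_curve (f : MvPolynomial (Fin 3) ℂ) (γ : Fin 3 → Polynomial ℂ) (u : ℂ) :
    (aeval γ f).eval u = MvPolynomial.eval (fun i => (γ i).eval u) f := by
  induction f using MvPolynomial.induction_on with
  | C a => simp
  | add p q hp hq => simp [hp, hq]
  | mul_X p j hp => simp [hp]

/-- A polynomial vanishing to order `m` at a point vanishes to order `m` along any curve through
that point. -/
lemma VanishesToOrder.pow_dvd_aeval {f : MvPolynomial (Fin 3) ℂ} {p : Fin 3 → ℂ} {m : ℕ}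
    (h : VanishesToOrder f p m) (γ : Fin 3 → Polynomial ℂ) (u : ℂ)
    (hγ : (fun i => (γ i).eval u) = p) :
    (Polynomial.X - Polynomial.C u) ^ m ∣ aeval γ f := by
  induction m generalizing f with
  | zero => simp
  | succ m ih =>
    have hder : (Polynomial.X - Polynomial.C u) ^ m ∣ Polynomial.derivative (aeval γ f) := by
      rw [derivative_aeval_eq_sum]
      exact Finset.dvd_sum fun i _ => (ih (h.pderiv i)).mul_right _
    have hroot : (aeval γ f).IsRoot u := by
      rw [Polynomial.IsRoot, eval_aeval_curve, hγ]
      exact h [] (by simp)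
    by_cases h0 : aeval γ f = 0
    · simp [h0]
    have hpos := (Polynomial.rootMultiplicity_pos h0).2 hroot
    have hder0 : Polynomial.derivative (aeval γ f) ≠ 0 := fun hd => by
      rw [Polynomial.eq_C_of_derivative_eq_zero hd] at hroot h0
      simp_all
    rw [← Polynomial.le_rootMultiplicity_iff hder0,
      Polynomial.derivative_rootMultiplicity_of_root hroot] at hder
    rw [← Polynomial.le_rootMultiplicity_iff h0]
    omega

lemma dvd_of_forall_pow_rootMultiplicity_dvd {P F : Polynomial ℂ} (hP : P ≠ 0)
    (h : ∀ r, (Polynomial.X - Polynomial.C r) ^ P.rootMultiplicity r ∣ F) : P ∣ F := by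
  by_cases hF : F = 0
  · simp [hF]
  rw [IsAlgClosed.dvd_iff_roots_le_roots hP hF, Multiset.le_iff_count]
  intro r
  rw [Polynomial.count_roots, Polynomial.count_roots, Polynomial.le_rootMultiplicity_iff hF]
  exact h r

lemma pow_dvd_of_nodup_roots {P F : Polynomial ℂ} {k : ℕ} (hP : P ≠ 0) (hn : P.roots.Nodup)
    (h : ∀ r, P.IsRoot r → (Polynomial.X - Polynomial.C r) ^ k ∣ F) : P ^ k ∣ F := by
  refine dvd_of_forall_pow_rootMultiplicity_dvd (pow_ne_zero k hP) fun r => ?_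
  rw [← Polynomial.count_roots, Polynomial.roots_pow, Multiset.count_nsmul]
  by_cases hr : P.IsRoot r
  · refine (pow_dvd_pow _ ?_).trans (h r hr)
    simpa using Nat.mul_le_mul_left k (Multiset.nodup_iff_count_le_one.1 hn r)
  · simp [Polynomial.rootMultiplicity_eq_zero hr]

lemma nodup_roots_of_derivative_ne_zero {P : Polynomial ℂ} (hP : P ≠ 0)
    (h : ∀ r, P.eval r = 0 → P.derivative.eval r ≠ 0) : P.roots.Nodup := by
  refine Multiset.nodup_iff_count_le_one.2 fun r => ?_
  rw [Polynomial.count_roots]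
  by_contra! hr
  obtain ⟨h1, h2⟩ := (Polynomial.one_lt_rootMultiplicity_iff_isRoot hP).1 hr
  exact h r h1 h2

lemma isCoprime_X_sub_C_of_eval_ne_zero {P : Polynomial ℂ} {r : ℂ} (h : P.eval r ≠ 0) :
    IsCoprime (Polynomial.X - Polynomial.C r) P :=
  (Polynomial.irreducible_X_sub_C r).coprime_iff_not_dvd.2 fun hd =>
    h (Polynomial.dvd_iff_isRoot.1 hd)

lemma MvPolynomial.IsHomogeneous.eval_smul_eq {f : MvPolynomial (Fin 3) ℂ} {n : ℕ}
    (hf : f.IsHomogeneous n) (c : ℂ) (p : Fin 3 → ℂ) :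
    MvPolynomial.eval (c • p) f = c ^ n * MvPolynomial.eval p f := by
  rw [MvPolynomial.eval_eq, MvPolynomial.eval_eq, Finset.mul_sum]
  refine Finset.sum_congr rfl fun d hd => ?_
  have hdeg := hf.degree_eq_sum_deg_support hd
  simp only [Pi.smul_apply, smul_eq_mul, mul_pow, Finset.prod_mul_distrib,
    Finset.prod_pow_eq_pow_sum]
  rw [hdeg]
  ring

/-- The parametrization of the cubic `h₁ = 0` by the lines through its node `(0,1,1)`. -/
noncomputable def nodalParam₁ : Fin 3 → Polynomial ℂ :=
  ![Polynomial.X ^ 2 - 1, Polynomial.X * (Polynomial.X ^ 2 - 1) + 1, 1]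

/-- The parametrization of the cubic `h₂ = 0` by the lines through its node `(0,0,1)`. -/
noncomputable def nodalParam₂ : Fin 3 → Polynomial ℂ :=
  ![-(Polynomial.X ^ 2 + 2 * Polynomial.X),
    -(Polynomial.X * (Polynomial.X ^ 2 + 2 * Polynomial.X)), 1 - 2 * Polynomial.X ^ 2]

lemma aeval_nodalParam₁_h₁ : aeval nodalParam₁ h₁ = 0 := by
  simp [h₁, nodalParam₁]; ring

lemma aeval_nodalParam₂_h₂ : aeval nodalParam₂ h₂ = 0 := by
  simp [h₂, nodalParam₂]; ring

lemma aeval_nodalParam₁_h₂ : aeval nodalParam₁ h₂ =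
    -2 * Polynomial.X ^ 8 + 8 * Polynomial.X ^ 6 - 2 * Polynomial.X ^ 5 - 11 * Polynomial.X ^ 4
      + 6 * Polynomial.X ^ 3 + 6 * Polynomial.X ^ 2 - 4 * Polynomial.X := by
  simp [h₂, nodalParam₁]; ring

lemma aeval_nodalParam₂_h₁ : aeval nodalParam₂ h₁ =
    -2 * Polynomial.X ^ 8 + 4 * Polynomial.X ^ 6 + 10 * Polynomial.X ^ 5 + 19 * Polynomial.X ^ 4
      + 6 * Polynomial.X ^ 3 - 6 * Polynomial.X ^ 2 + 1 := by
  simp [h₁, nodalParam₂]; ring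

lemma natDegree_aeval_nodalParam₁_h₂ : (aeval nodalParam₁ h₂).natDegree = 8 := by
  rw [aeval_nodalParam₁_h₂]
  compute_degree!

lemma natDegree_aeval_nodalParam₂_h₁ : (aeval nodalParam₂ h₁).natDegree = 8 := by
  rw [aeval_nodalParam₂_h₁]
  compute_degree!

lemma aeval_nodalParam₁_h₂_ne_zero : aeval nodalParam₁ h₂ ≠ 0 :=
  Polynomial.ne_zero_of_natDegree_gt (n := 0) (by simp [natDegree_aeval_nodalParam₁_h₂])

lemma aeval_nodalParam₂_h₁_ne_zero : aeval nodalParam₂ h₁ ≠ 0 :=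
  Polynomial.ne_zero_of_natDegree_gt (n := 0) (by simp [natDegree_aeval_nodalParam₂_h₁])

lemma nodup_roots_aeval_nodalParam₁_h₂ : (aeval nodalParam₁ h₂).roots.Nodup := by
  refine nodup_roots_of_derivative_ne_zero aeval_nodalParam₁_h₂_ne_zero fun r hr hr' => ?_
  rw [aeval_nodalParam₁_h₂] at hr hr'
  simp at hr hr'
  have : (52528 : ℂ) = 0 := by
    linear_combination (-1 : ℂ) *
      (-190448 * r ^ 6 - 135264 * r ^ 5 + 504048 * r ^ 4 + 224554 * r ^ 3 - 448688 * r ^ 2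
        + 2202 * r + 118744) * hr -
      (23806 * r ^ 7 + 16908 * r ^ 6 - 86812 * r ^ 5 - 36050 * r ^ 4 + 119481 * r ^ 3
        - 3036 * r ^ 2 - 79348 * r + 13132) * hr'
  norm_num at this

lemma nodup_roots_aeval_nodalParam₂_h₁ : (aeval nodalParam₂ h₁).roots.Nodup := by
  refine nodup_roots_of_derivative_ne_zero aeval_nodalParam₂_h₁_ne_zero fun r hr hr' => ?_
  rw [aeval_nodalParam₂_h₁] at hr hr'
  simp at hr hr'
  have : (126119728 : ℂ) = 0 := by
    linear_combination (-1 : ℂ) *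
      (-270650096 * r ^ 6 + 240522288 * r ^ 5 + 220669144 * r ^ 4 + 678490294 * r ^ 3
        + 618570054 * r ^ 2 - 344875260 * r - 126119728) * hr -
      (33831262 * r ^ 7 - 30065286 * r ^ 6 - 44499274 * r ^ 5 - 133212260 * r ^ 4
        - 193228965 * r ^ 3 + 91148067 * r ^ 2 + 71497961 * r - 28739605) * hr'
  norm_num at this

lemma aeval_nodalParam₁_eq_zero {f : MvPolynomial (Fin 3) ℂ} (hf : f.IsHomogeneous 10)
    (hbase : ∀ p : Fin 3 → ℂ, p ≠ 0 → MvPolynomial.eval p h₁ = 0 →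
      MvPolynomial.eval p h₂ = 0 → VanishesToOrder f p 3)
    (hB1 : VanishesToOrder f ![0, 1, 1] 5) : aeval nodalParam₁ f = 0 := by
  have hP : aeval nodalParam₁ h₂ ^ 3 ∣ aeval nodalParam₁ f := by
    refine pow_dvd_of_nodup_roots aeval_nodalParam₁_h₂_ne_zero nodup_roots_aeval_nodalParam₁_h₂
      fun r hr => (hbase _ ?_ ?_ ?_).pow_dvd_aeval nodalParam₁ r rfl
    · exact fun h => by simpa [nodalParam₁] using congrFun h 2
    · rw [← eval_aeval_curve, aeval_nodalParam₁_h₁, Polynomial.eval_zero]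
    · rw [← eval_aeval_curve]
      exact hr
  have h1 := hB1.pow_dvd_aeval nodalParam₁ 1 (by ext i; fin_cases i <;> simp [nodalParam₁])
  have h2 := hB1.pow_dvd_aeval nodalParam₁ (-1) (by ext i; fin_cases i <;> simp [nodalParam₁])
  have hc : IsCoprime (Polynomial.X - Polynomial.C (1 : ℂ))
      (Polynomial.X - Polynomial.C (-1 : ℂ)) :=
    isCoprime_X_sub_C_of_eval_ne_zero (by norm_num)
  have hc1 : IsCoprime (Polynomial.X - Polynomial.C (1 : ℂ)) (aeval nodalParam₁ h₂) :=
    isCoprime_X_sub_C_of_eval_ne_zero (by rw [aeval_nodalParam₁_h₂]; norm_num)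
  have hc2 : IsCoprime (Polynomial.X - Polynomial.C (-1 : ℂ)) (aeval nodalParam₁ h₂) :=
    isCoprime_X_sub_C_of_eval_ne_zero (by rw [aeval_nodalParam₁_h₂]; norm_num)
  have hdvd := (hc1.pow.mul_left hc2.pow).mul_dvd (hc.pow.mul_dvd h1 h2) hP
  refine Polynomial.eq_zero_of_dvd_of_natDegree_lt hdvd ?_
  have hdeg : (aeval nodalParam₁ f).natDegree ≤ 10 * 3 :=
    aeval_natDegree_le f hf.totalDegree_le _ fun i => by
      fin_cases i <;> simp [nodalParam₁] <;> compute_degree!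
  rw [Polynomial.natDegree_mul
      (mul_ne_zero (pow_ne_zero _ (Polynomial.X_sub_C_ne_zero _))
        (pow_ne_zero _ (Polynomial.X_sub_C_ne_zero _)))
      (pow_ne_zero _ aeval_nodalParam₁_h₂_ne_zero),
    Polynomial.natDegree_mul (pow_ne_zero _ (Polynomial.X_sub_C_ne_zero _))
      (pow_ne_zero _ (Polynomial.X_sub_C_ne_zero _)),
    Polynomial.natDegree_pow, Polynomial.natDegree_pow, Polynomial.natDegree_pow,
    Polynomial.natDegree_X_sub_C, Polynomial.natDegree_X_sub_C, natDegree_aeval_nodalParam₁_h₂]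
  omega

lemma aeval_nodalParam₂_eq_zero {f : MvPolynomial (Fin 3) ℂ} (hf : f.IsHomogeneous 10)
    (hbase : ∀ p : Fin 3 → ℂ, p ≠ 0 → MvPolynomial.eval p h₁ = 0 →
      MvPolynomial.eval p h₂ = 0 → VanishesToOrder f p 3)
    (hB2 : VanishesToOrder f ![0, 0, 1] 6) : aeval nodalParam₂ f = 0 := by
  have hP : aeval nodalParam₂ h₁ ^ 3 ∣ aeval nodalParam₂ f := by
    refine pow_dvd_of_nodup_roots aeval_nodalParam₂_h₁_ne_zero nodup_roots_aeval_nodalParam₂_h₁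
      fun r hr => (hbase _ ?_ ?_ ?_).pow_dvd_aeval nodalParam₂ r rfl
    · intro h
      have hx : r ^ 2 + 2 * r = 0 := by
        have := congrFun h 0
        simp [nodalParam₂] at this
        linear_combination -this
      have hz : 1 - 2 * r ^ 2 = 0 := by simpa [nodalParam₂] using congrFun h 2
      have : (7 : ℂ) = 0 := by linear_combination (8 * r - 2) * hx + (4 * r + 7) * hz
      norm_num at this
    · rw [← eval_aeval_curve]
      exact hr
    · rw [← eval_aeval_curve, aeval_nodalParam₂_h₂, Polynomial.eval_zero]
  have h1 := hB2.pow_dvd_aeval nodalParam₂ 0 (by ext i; fin_cases i <;> simp [nodalParam₂])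
  have h2 : (Polynomial.X - Polynomial.C (-2)) ∣ aeval nodalParam₂ f := by
    have hpt : (fun i => (nodalParam₂ i).eval (-2)) = (-7 : ℂ) • ![0, 0, 1] := by
      ext i; fin_cases i <;> norm_num [nodalParam₂]
    rw [Polynomial.dvd_iff_isRoot, Polynomial.IsRoot, eval_aeval_curve, hpt, hf.eval_smul_eq,
      show MvPolynomial.eval ![0, 0, 1] f = 0 from hB2 [] (by simp), mul_zero]
  have hc : IsCoprime (Polynomial.X - Polynomial.C (0 : ℂ))
      (Polynomial.X - Polynomial.C (-2 : ℂ)) :=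
    isCoprime_X_sub_C_of_eval_ne_zero (by norm_num)
  have hc1 : IsCoprime (Polynomial.X - Polynomial.C (0 : ℂ)) (aeval nodalParam₂ h₁) :=
    isCoprime_X_sub_C_of_eval_ne_zero (by rw [aeval_nodalParam₂_h₁]; norm_num)
  have hc2 : IsCoprime (Polynomial.X - Polynomial.C (-2 : ℂ)) (aeval nodalParam₂ h₁) :=
    isCoprime_X_sub_C_of_eval_ne_zero (by rw [aeval_nodalParam₂_h₁]; norm_num)
  have hdvd := (hc1.pow.mul_left hc2.pow_right).mul_dvd (hc.pow_left.mul_dvd h1 h2) hP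
  refine Polynomial.eq_zero_of_dvd_of_natDegree_lt hdvd ?_
  have hdeg : (aeval nodalParam₂ f).natDegree ≤ 10 * 3 :=
    aeval_natDegree_le f hf.totalDegree_le _ fun i => by
      fin_cases i <;> simp [nodalParam₂] <;> compute_degree!
  rw [Polynomial.natDegree_mul
      (mul_ne_zero (pow_ne_zero _ (Polynomial.X_sub_C_ne_zero _)) (Polynomial.X_sub_C_ne_zero _))
      (pow_ne_zero _ aeval_nodalParam₂_h₁_ne_zero),
    Polynomial.natDegree_mul (pow_ne_zero _ (Polynomial.X_sub_C_ne_zero _))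
      (Polynomial.X_sub_C_ne_zero _),
    Polynomial.natDegree_pow, Polynomial.natDegree_pow,
    Polynomial.natDegree_X_sub_C, Polynomial.natDegree_X_sub_C, natDegree_aeval_nodalParam₂_h₁]
  omega

/-- Away from the line `z = 0`, the cubic `h₁ = 0` is covered by its parametrization. -/
lemma exists_eq_smul_nodalParam₁ {p : Fin 3 → ℂ} (hp : MvPolynomial.eval p h₁ = 0)
    (hz : p 2 ≠ 0) : ∃ c u : ℂ, p = c • fun i => (nodalParam₁ i).eval u := by
  simp [h₁] at hp
  by_cases hx : p 0 = 0
  · have hy : p 1 - p 2 = 0 := by simpa [hx, hz] using hp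
    refine ⟨p 2, 1, ?_⟩
    ext i
    fin_cases i <;> simp [nodalParam₁, hx, sub_eq_zero.1 hy]
  · have hu : p 0 = p 2 * (((p 1 - p 2) / p 0) ^ 2 - 1) := by
      field_simp
      linear_combination -hp
    refine ⟨p 2, (p 1 - p 2) / p 0, ?_⟩
    ext i
    fin_cases i
    · simpa [nodalParam₁] using hu
    · have : p 1 = (p 1 - p 2) / p 0 * p 0 + p 2 := by field_simp; ring
      simp [nodalParam₁]
      linear_combination this + (p 1 - p 2) / p 0 * hu
    · simp [nodalParam₁]

/-- Away from the line `x = 0`, the cubic `h₂ = 0` is covered by its parametrization. -/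
lemma exists_eq_smul_nodalParam₂ {p : Fin 3 → ℂ} (hp : MvPolynomial.eval p h₂ = 0)
    (hx : p 0 ≠ 0) : ∃ c u : ℂ, p = c • fun i => (nodalParam₂ i).eval u := by
  simp [h₂] at hp
  obtain ⟨u, hu⟩ : ∃ u, p 1 = u * p 0 := ⟨p 1 / p 0, by field_simp⟩
  have hu' : p 0 * (1 - 2 * u ^ 2) = -(u ^ 2 + 2 * u) * p 2 := by
    rw [hu] at hp
    refine mul_left_cancel₀ (pow_ne_zero 2 hx) ?_
    linear_combination hp
  have hw : u ^ 2 + 2 * u ≠ 0 := fun hw => by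
    have hv : 1 - 2 * u ^ 2 = 0 := by simpa [hw, hx] using hu'
    have : (7 : ℂ) = 0 := by linear_combination (8 * u - 2) * hw + (4 * u + 7) * hv
    norm_num at this
  have h0 : p 0 = -(p 0 / (u ^ 2 + 2 * u)) * -(u ^ 2 + 2 * u) := by
    rw [neg_mul_neg, div_mul_cancel₀ _ hw]
  refine ⟨-(p 0 / (u ^ 2 + 2 * u)), u, ?_⟩
  ext i
  fin_cases i
  · simpa [nodalParam₂] using h0
  · simp [nodalParam₂]
    linear_combination hu + u * h0
  · simp [nodalParam₂]
    rw [neg_mul_eq_neg_mul, neg_div', div_mul_eq_mul_div, eq_div_iff hw]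
    linear_combination hu'

lemma eval_eq_zero_of_eval_h₁_eq_zero {f : MvPolynomial (Fin 3) ℂ} (hf : f.IsHomogeneous 10)
    (hbase : ∀ p : Fin 3 → ℂ, p ≠ 0 → MvPolynomial.eval p h₁ = 0 →
      MvPolynomial.eval p h₂ = 0 → VanishesToOrder f p 3)
    (hB1 : VanishesToOrder f ![0, 1, 1] 5) {p : Fin 3 → ℂ}
    (hp : MvPolynomial.eval p h₁ = 0) : MvPolynomial.eval p f = 0 := by
  by_cases hz : p 2 = 0
  · by_cases h0 : p = 0
    · rw [h0, ← zero_smul ℂ (0 : Fin 3 → ℂ), hf.eval_smul_eq]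
      simp
    · have hx : p 0 = 0 := by simpa [h₁, hz] using hp
      exact hbase p h0 hp (by simp [h₂, hx, hz]) [] (by simp)
  · obtain ⟨c, u, rfl⟩ := exists_eq_smul_nodalParam₁ hp hz
    rw [hf.eval_smul_eq, ← eval_aeval_curve, aeval_nodalParam₁_eq_zero hf hbase hB1,
      Polynomial.eval_zero, mul_zero]

lemma eval_eq_zero_of_eval_h₂_eq_zero {f : MvPolynomial (Fin 3) ℂ} (hf : f.IsHomogeneous 10)
    (hbase : ∀ p : Fin 3 → ℂ, p ≠ 0 → MvPolynomial.eval p h₁ = 0 →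
      MvPolynomial.eval p h₂ = 0 → VanishesToOrder f p 3)
    (hB2 : VanishesToOrder f ![0, 0, 1] 6) {p : Fin 3 → ℂ}
    (hp : MvPolynomial.eval p h₂ = 0) : MvPolynomial.eval p f = 0 := by
  by_cases hx : p 0 = 0
  · have hyz : p 1 = 0 ∨ p 2 = 0 := by simpa [h₂, hx] using hp
    rcases hyz with hy | hz
    · have hpt : p = p 2 • ![0, 0, 1] := by
        ext i; fin_cases i <;> simp [hx, hy]
      rw [hpt, hf.eval_smul_eq, show MvPolynomial.eval ![0, 0, 1] f = 0 from hB2 [] (by simp),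
        mul_zero]
    · by_cases h0 : p = 0
      · rw [h0, ← zero_smul ℂ (0 : Fin 3 → ℂ), hf.eval_smul_eq]
        simp
      · exact hbase p h0 (by simp [h₁, hx, hz]) hp [] (by simp)
  · obtain ⟨c, u, rfl⟩ := exists_eq_smul_nodalParam₂ hp hx
    rw [hf.eval_smul_eq, ← eval_aeval_curve, aeval_nodalParam₂_eq_zero hf hbase hB2,
      Polynomial.eval_zero, mul_zero]

/-- The line through `(4,9,6)` with direction `v`. -/
noncomputable def lineParam (v : Fin 3 → ℂ) : Fin 3 → Polynomial ℂ :=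
  fun i => Polynomial.C (![4, 9, 6] i) + Polynomial.C (v i) * Polynomial.X

/-- The restriction of `h₁` to the line through `(4,9,6)` with direction `(x, y, z)`. -/
def lineCubic₁ {R : Type*} [CommRing R] (x y z : R) : Cubic R where
  a := (y - z) ^ 2 * z - x ^ 3 - x ^ 2 * z
  b := -18 * x ^ 2 - 8 * x * z + 6 * y ^ 2 - 6 * y * z
  c := -96 * x + 36 * y - 43 * z
  d := -106

/-- The restriction of `h₂` to the line through `(4,9,6)` with direction `(x, y, z)`. -/
def lineCubic₂ {R : Type*} [CommRing R] (x y z : R) : Cubic R where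
  a := x ^ 3 - 2 * x * y ^ 2 + 2 * x * y * z + y ^ 2 * z
  b := 12 * x ^ 2 - 24 * x * y + 18 * x * z - 2 * y ^ 2 + 26 * y * z
  c := -6 * x + 12 * y + 153 * z
  d := 334

/-- It is nonzero exactly when the line through `(4,9,6)` with direction `(x, y, z)` meets each of
the two nodal cubics in three distinct points, all of them at finite parameter. -/
def lineDiscr {R : Type*} [CommRing R] (x y z : R) : R :=
  (lineCubic₁ x y z).a * (lineCubic₁ x y z).discr *
    ((lineCubic₂ x y z).a * (lineCubic₂ x y z).discr)

lemma aeval_lineParam_h₁ (v : Fin 3 → ℂ) :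
    aeval (lineParam v) h₁ = (lineCubic₁ (v 0) (v 1) (v 2)).toPoly := by
  refine Polynomial.funext fun t => ?_
  simp [h₁, lineParam, lineCubic₁, Cubic.toPoly]
  ring

lemma aeval_lineParam_h₂ (v : Fin 3 → ℂ) :
    aeval (lineParam v) h₂ = (lineCubic₂ (v 0) (v 1) (v 2)).toPoly := by
  refine Polynomial.funext fun t => ?_
  simp [h₂, lineParam, lineCubic₂, Cubic.toPoly]
  ring

lemma Cubic.nodup_roots_toPoly {P : Cubic ℂ} (ha : P.a ≠ 0) (hd : P.discr ≠ 0) :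
    P.toPoly.roots.Nodup := by
  have := (Cubic.discr_ne_zero_iff_roots_nodup (φ := RingHom.id ℂ) ha
    (IsAlgClosed.splits _)).1 hd
  rwa [Cubic.map_roots, Polynomial.map_id] at this

/-- Every homogeneous polynomial of degree 10 vanishing to order `≥ 3` at each of the nine base
points of the pencil `⟨h₁, h₂⟩`, to order `≥ 5` at `(4,9,6)`, to order `≥ 5` at `(0,1,1)`
and to order `≥ 6` at `(0,0,1)` is zero (the computation `h⁰₁₂,₁₀ = 0`). -/
theorem degree_ten_vanishing_h0_12_10
    (f : MvPolynomial (Fin 3) ℂ)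
    (hf : f.IsHomogeneous 10)
    (hbase : ∀ p : Fin 3 → ℂ, p ≠ 0 → MvPolynomial.eval p h₁ = 0 →
      MvPolynomial.eval p h₂ = 0 → VanishesToOrder f p 3)
    (hE0 : VanishesToOrder f ![4, 9, 6] 5)
    (hB1 : VanishesToOrder f ![0, 1, 1] 5)
    (hB2 : VanishesToOrder f ![0, 0, 1] 6) :
    f = 0 := by
  have hline : ∀ v : Fin 3 → ℂ, lineDiscr (v 0) (v 1) (v 2) ≠ 0 → aeval (lineParam v) f = 0 := by
    intro v hv
    simp only [lineDiscr, mul_ne_zero_iff] at hv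
    obtain ⟨⟨ha₁, hd₁⟩, ha₂, hd₂⟩ := hv
    set P := aeval (lineParam v) h₁ with hP
    set Q := aeval (lineParam v) h₂ with hQ
    rw [aeval_lineParam_h₁] at hP
    rw [aeval_lineParam_h₂] at hQ
    have hP3 : P.natDegree = 3 := by rw [hP, Cubic.natDegree_of_a_ne_zero ha₁]
    have hQ3 : Q.natDegree = 3 := by rw [hQ, Cubic.natDegree_of_a_ne_zero ha₂]
    have hP0 : P ≠ 0 := Polynomial.ne_zero_of_natDegree_gt (n := 0) (by simp [hP3])
    have hQ0 : Q ≠ 0 := Polynomial.ne_zero_of_natDegree_gt (n := 0) (by simp [hQ3])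
    have hPn : ∀ r, P.rootMultiplicity r ≤ 1 := fun r => by
      rw [← Polynomial.count_roots, hP]
      exact Multiset.nodup_iff_count_le_one.1 (Cubic.nodup_roots_toPoly ha₁ hd₁) r
    have hQn : ∀ r, Q.rootMultiplicity r ≤ 1 := fun r => by
      rw [← Polynomial.count_roots, hQ]
      exact Multiset.nodup_iff_count_le_one.1 (Cubic.nodup_roots_toPoly ha₂ hd₂) r
    have hPe : P.eval 0 ≠ 0 := by simp [hP, Cubic.toPoly, lineCubic₁]
    have hQe : Q.eval 0 ≠ 0 := by simp [hQ, Cubic.toPoly, lineCubic₂]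
    have hPQ : P * Q ∣ aeval (lineParam v) f := by
      refine dvd_of_forall_pow_rootMultiplicity_dvd (mul_ne_zero hP0 hQ0) fun r => ?_
      rw [Polynomial.rootMultiplicity_mul (mul_ne_zero hP0 hQ0)]
      by_cases hPr : P.IsRoot r
      · by_cases hQr : Q.IsRoot r
        · have hv := hbase (fun i => (lineParam v i).eval r) ?_
            ((eval_aeval_curve _ _ _).symm.trans hPr) ((eval_aeval_curve _ _ _).symm.trans hQr)
          · exact (pow_dvd_pow _ (by linarith [hPn r, hQn r])).trans
              (hv.pow_dvd_aeval (lineParam v) r rfl)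
          · intro h0
            have hx : 4 + v 0 * r = 0 := by simpa [lineParam] using congrFun h0 0
            have hy : 9 + v 1 * r = 0 := by simpa [lineParam] using congrFun h0 1
            have hz : 6 + v 2 * r = 0 := by simpa [lineParam] using congrFun h0 2
            refine hd₁ ?_
            have hy' : v 1 = 9 / 4 * v 0 := by
              linear_combination v 1 / 4 * hx - v 0 / 4 * hy
            have hz' : v 2 = 6 / 4 * v 0 := by
              linear_combination v 2 / 4 * hx - v 0 / 4 * hz
            rw [hy', hz']
            simp only [lineCubic₁, Cubic.discr]
            ring
        · rw [Polynomial.rootMultiplicity_eq_zero hQr, add_zero]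
          refine (pow_dvd_pow _ (hPn r)).trans ?_
          rw [pow_one, Polynomial.dvd_iff_isRoot, Polynomial.IsRoot, eval_aeval_curve]
          exact eval_eq_zero_of_eval_h₁_eq_zero hf hbase hB1
            ((eval_aeval_curve _ _ _).symm.trans hPr)
      · rw [Polynomial.rootMultiplicity_eq_zero hPr, zero_add]
        by_cases hQr : Q.IsRoot r
        · refine (pow_dvd_pow _ (hQn r)).trans ?_
          rw [pow_one, Polynomial.dvd_iff_isRoot, Polynomial.IsRoot, eval_aeval_curve]
          exact eval_eq_zero_of_eval_h₂_eq_zero hf hbase hB2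
            ((eval_aeval_curve _ _ _).symm.trans hQr)
        · simp [Polynomial.rootMultiplicity_eq_zero hQr]
    have h0 : (Polynomial.X - Polynomial.C 0) ^ 5 ∣ aeval (lineParam v) f :=
      hE0.pow_dvd_aeval (lineParam v) 0 (by ext i; simp [lineParam])
    have hc : IsCoprime (Polynomial.X - Polynomial.C 0) (P * Q) :=
      isCoprime_X_sub_C_of_eval_ne_zero (by simp [hPe, hQe])
    refine Polynomial.eq_zero_of_dvd_of_natDegree_lt (hc.pow_left.mul_dvd h0 hPQ) ?_
    have hdeg : (aeval (lineParam v) f).natDegree ≤ 10 * 1 :=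
      aeval_natDegree_le f hf.totalDegree_le _ fun i => by
        simp only [lineParam]
        compute_degree
    rw [Polynomial.natDegree_mul (pow_ne_zero _ (Polynomial.X_sub_C_ne_zero _))
      (mul_ne_zero hP0 hQ0), Polynomial.natDegree_mul hP0 hQ0, Polynomial.natDegree_pow,
      Polynomial.natDegree_X_sub_C, hP3, hQ3]
    omega
  set D : MvPolynomial (Fin 3) ℂ := lineDiscr (X 0 - C 4) (X 1 - C 9) (X 2 - C 6) with hD
  have hDe : ∀ p, MvPolynomial.eval p D = lineDiscr (p 0 - 4) (p 1 - 9) (p 2 - 6) := fun p => by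
    simp [hD, lineDiscr, lineCubic₁, lineCubic₂, Cubic.discr]
  have hD0 : D ≠ 0 := fun h => by
    have := hDe ![5, 11, 9]
    rw [h] at this
    simp [lineDiscr, lineCubic₁, lineCubic₂, Cubic.discr] at this
    norm_num at this
  refine (mul_eq_zero.1 (MvPolynomial.funext fun p => ?_)).resolve_right hD0
  rw [map_mul, map_zero, mul_eq_zero, or_iff_not_imp_right, hDe]
  intro hp
  have := congrArg (Polynomial.eval 1) (hline (p - ![4, 9, 6]) (by simpa using hp))
  rw [eval_aeval_curve] at this
  simpa [lineParam] using this
end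

section
/- Let h₂ = x³ − 2xy² + 2xyz + y²z in ℂ[x,y,z]. The set of nonzero (a,b,c) ∈ ℂ³ at which h₂ and all three first-order partial derivatives ∂h₂/∂x, ∂h₂/∂y, ∂h₂/∂z vanish simultaneously is exactly the set of nonzero scalar multiples of (0,0,1). In other words, the projective plane cubic {h₂ = 0} has a unique singular point, namely [0:0:1]. -/
open MvPolynomial

theorem eval_h₂ (p : Fin 3 → ℂ) :
    eval p h₂ = p 0 ^ 3 - 2 * p 0 * p 1 ^ 2 + 2 * p 0 * p 1 * p 2 + p 1 ^ 2 * p 2 := by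
  simp [h₂]

theorem pderiv_ofNat_two (i : Fin 3) : pderiv i (2 : MvPolynomial (Fin 3) ℂ) = 0 := by
  exact_mod_cast (pderiv i).map_natCast 2

theorem eval_pderiv_zero_h₂ (p : Fin 3 → ℂ) :
    eval p (pderiv 0 h₂) = 3 * p 0 ^ 2 - 2 * p 1 ^ 2 + 2 * p 1 * p 2 := by
  simp [h₂, pderiv_X, pderiv_ofNat_two, Derivation.leibniz, Derivation.leibniz_pow]
  ring

theorem eval_pderiv_one_h₂ (p : Fin 3 → ℂ) :
    eval p (pderiv 1 h₂) = -4 * p 0 * p 1 + 2 * p 0 * p 2 + 2 * p 1 * p 2 := by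
  simp [h₂, pderiv_X, pderiv_ofNat_two, Derivation.leibniz, Derivation.leibniz_pow]
  ring

theorem eval_pderiv_two_h₂ (p : Fin 3 → ℂ) :
    eval p (pderiv 2 h₂) = p 1 * (2 * p 0 + p 1) := by
  simp [h₂, pderiv_X, pderiv_ofNat_two, Derivation.leibniz, Derivation.leibniz_pow]
  ring

/-- The three partial derivatives of `h₂` have no common zero off the line `x = y = 0`. -/
theorem eq_zero_of_partials_h₂ {x y z : ℂ} (hx : 3 * x ^ 2 - 2 * y ^ 2 + 2 * y * z = 0)
    (hy : -4 * x * y + 2 * x * z + 2 * y * z = 0) (hz : y * (2 * x + y) = 0) :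
    x = 0 ∧ y = 0 := by
  rcases mul_eq_zero.1 hz with rfl | h
  · exact ⟨by simpa using hx, rfl⟩
  · obtain rfl : y = -2 * x := by linear_combination h
    have : x ^ 2 = 0 := by linear_combination (2 * hy - hx) / 21
    have hx0 : x = 0 := by simpa using this
    simp [hx0]

/-- The nonzero points of `ℂ³` at which `h₂` and all its first-order partial derivatives vanish
are exactly the nonzero scalar multiples of `(0,0,1)`: the projective cubic `{h₂ = 0}` has
the unique singular point `[0:0:1]`. -/
theorem h₂_unique_singular_point :
    ∀ p : Fin 3 → ℂ, p ≠ 0 →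
      ((MvPolynomial.eval p h₂ = 0 ∧
          ∀ i : Fin 3, MvPolynomial.eval p (MvPolynomial.pderiv i h₂) = 0) ↔
        ∃ c : ℂ, c ≠ 0 ∧ p = c • ![0, 0, 1]) := by
  intro p hp
  constructor
  · rintro ⟨-, h⟩
    obtain ⟨h0, h1⟩ := eq_zero_of_partials_h₂ (eval_pderiv_zero_h₂ p ▸ h 0)
      (eval_pderiv_one_h₂ p ▸ h 1) (eval_pderiv_two_h₂ p ▸ h 2)
    have hp' : p = p 2 • ![0, 0, 1] := by
      ext i
      fin_cases i <;> simp [h0, h1]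
    refine ⟨p 2, fun h2 => hp ?_, hp'⟩
    rw [hp', h2, zero_smul]
  · rintro ⟨c, -, rfl⟩
    refine ⟨by simp [eval_h₂], fun i => ?_⟩
    fin_cases i
    · simp [eval_pderiv_zero_h₂]
    · simp [eval_pderiv_one_h₂]
    · simp [eval_pderiv_two_h₂]
end
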